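/- arXiv:2212.11179 — 2 statements merged into one kernel-verified Lean document; each statement's English description precedes it below -/
import Mathlib

section
/- Let n ≥ 2, α > 0, ρ > 0, and define ψ(x) = ∫_{S^{n-1}} e^{i x·θ} d_*θ. Then for every x ∈ ℝ^n, the function y ↦ (1-|y|²)^{α-1} ψ(x - ρy) is integrable over the open unit ball of ℝ^n and (Γ(α+n/2)/(π^{n/2} Γ(α))) ∫_{|y|<1} (1-|y|²)^{α-1} ψ(x - ρy) dy = j_{n/2+α-1}(ρ) · ψ(x). -/
open MeasureTheory Metric
open scoped ENNReal Real RealInnerProductSpace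

/-- The rotation-invariant probability measure `d_*θ` on the unit sphere
`S^{n-1} ⊂ ℝ^n` (surface measure normalized to total mass 1). -/
noncomputable def normSphereMeasure (n : ℕ) :
    Measure (sphere (0 : EuclideanSpace ℝ (Fin n)) 1) :=
  ((volume : Measure (EuclideanSpace ℝ (Fin n))).toSphere Set.univ)⁻¹ •
    (volume : Measure (EuclideanSpace ℝ (Fin n))).toSphere

/-- `ψ(x) = ∫_{S^{n-1}} e^{i x·θ} d_*θ`. -/
noncomputable def psiFun (n : ℕ) (x : EuclideanSpace ℝ (Fin n)) : ℂ :=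
  ∫ θ : sphere (0 : EuclideanSpace ℝ (Fin n)) 1,
    Complex.exp (Complex.I * (⟪x, (θ : EuclideanSpace ℝ (Fin n))⟫ : ℝ))
    ∂(normSphereMeasure n)

/-- The normalized Bessel function `j_ν(r) = Γ(ν+1) (r/2)^{-ν} J_ν(r)`, defined by its
power series. -/
noncomputable def besselj (ν : ℝ) (r : ℝ) : ℝ :=
  ∑' m : ℕ, (-1 : ℝ) ^ m *
    (Real.Gamma (ν + 1) / (m.factorial * Real.Gamma (m + ν + 1))) * (r / 2) ^ (2 * m)

theorem integral_pow_mul_exp_neg_sq (m : ℕ) :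
    ∫ t : ℝ, t ^ (2 * m) * Real.exp (-t ^ 2) = Real.Gamma (m + 1 / 2) := by
  have h := integral_comp_abs (f := fun t : ℝ ↦ t ^ (2 * m) * Real.exp (-t ^ 2))
  simp only [pow_mul, sq_abs] at h
  simp only [pow_mul]
  rw [h]
  have h2 := integral_rpow_mul_exp_neg_rpow (p := 2) (q := (2 * m : ℕ)) two_pos
    (by linarith [(2 * m : ℕ).cast_nonneg (α := ℝ)])
  simp only [Real.rpow_natCast, Real.rpow_two, pow_mul] at h2
  rw [h2, show (((2 * m : ℕ) : ℝ) + 1) / 2 = m + 1 / 2 by push_cast; ring]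
  ring

theorem integral_Ioo_rpow_mul_one_sub_rpow {s α : ℝ} (hs : 0 < s) (hα : 0 < α) :
    IntegrableOn (fun t : ℝ ↦ t ^ (s - 1) * (1 - t) ^ (α - 1)) (Set.Ioo 0 1) ∧
    ∫ t in Set.Ioo (0 : ℝ) 1, t ^ (s - 1) * (1 - t) ^ (α - 1) =
      Real.Gamma s * Real.Gamma α / Real.Gamma (s + α) := by
  have hint := Complex.betaIntegral_convergent (u := s) (v := α) (by simpa) (by simpa)
  have hcongr (t : ℝ) (ht : t ∈ Set.Ioc (0 : ℝ) 1) :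
      (t : ℂ) ^ ((s : ℂ) - 1) * (1 - (t : ℂ)) ^ ((α : ℂ) - 1) =
        ((t ^ (s - 1) * (1 - t) ^ (α - 1) : ℝ) : ℂ) := by
    push_cast
    rw [Complex.ofReal_cpow ht.1.le, Complex.ofReal_cpow (sub_nonneg.2 ht.2)]
    push_cast
    rfl
  rw [intervalIntegrable_iff_integrableOn_Ioc_of_le zero_le_one,
    integrableOn_congr_fun hcongr measurableSet_Ioc] at hint
  have hint' := hint.re
  refine ⟨IntegrableOn.mono_set (by simpa using! hint') Set.Ioo_subset_Ioc_self, ?_⟩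
  have h := ProbabilityTheory.beta_eq_betaIntegralReal s α hs hα
  rw [ProbabilityTheory.beta, Complex.betaIntegral, intervalIntegral.integral_of_le zero_le_one,
    setIntegral_congr_fun measurableSet_Ioc hcongr, integral_complex_ofReal, Complex.ofReal_re,
    integral_Ioc_eq_integral_Ioo] at h
  exact h.symm

/-- The weight `(1 - r²)^(α-1)` cut off at `r = 1`. -/
noncomputable def truncWeight (α : ℝ) : ℝ → ℝ :=
  (Set.Iio 1).indicator fun r ↦ (1 - r ^ 2) ^ (α - 1)

theorem measurable_truncWeight (α : ℝ) : Measurable (truncWeight α) :=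
  Measurable.indicator (by fun_prop) measurableSet_Iio

theorem truncWeight_nonneg (α : ℝ) {r : ℝ} (hr : 0 ≤ r) : 0 ≤ truncWeight α r := by
  refine Set.indicator_apply_nonneg fun h ↦ Real.rpow_nonneg ?_ _
  nlinarith [Set.mem_Iio.1 h]

theorem integral_Ioi_pow_mul_truncWeight {s α : ℝ} (hs : 0 < s) (hα : 0 < α) {j : ℕ}
    (hj : (j : ℝ) + 1 = 2 * s) :
    IntegrableOn (fun r ↦ r ^ j * truncWeight α r) (Set.Ioi 0) ∧
    ∫ r in Set.Ioi (0 : ℝ), r ^ j * truncWeight α r =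
      1 / 2 * (Real.Gamma s * Real.Gamma α / Real.Gamma (s + α)) := by
  set g : ℝ → ℝ := (Set.Ioo (0 : ℝ) 1).indicator fun t ↦ t ^ (s - 1) * (1 - t) ^ (α - 1) with hg
  have hcongr (r : ℝ) (hr : r ∈ Set.Ioi (0 : ℝ)) :
      r ^ ((2 : ℝ) - 1) * g (r ^ (2 : ℝ)) = r ^ j * truncWeight α r := by
    have hr0 : 0 < r := hr
    have hmem : r ^ 2 ∈ Set.Ioo (0 : ℝ) 1 ↔ r ∈ Set.Iio 1 := by
      simp [hr0, abs_of_pos hr0]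
    by_cases h : r ∈ Set.Iio (1 : ℝ)
    · rw [hg, Real.rpow_two, truncWeight, Set.indicator_of_mem (hmem.2 h),
        Set.indicator_of_mem h, ← mul_assoc, ← Real.rpow_natCast r 2, ← Real.rpow_mul hr0.le,
        ← Real.rpow_add hr0, ← Real.rpow_natCast r j]
      congr 2
      push_cast
      linarith
    · rw [hg, Real.rpow_two, truncWeight, Set.indicator_of_notMem (mt hmem.1 h),
        Set.indicator_of_notMem h, mul_zero, mul_zero]
  obtain ⟨hint, hval⟩ := integral_Ioo_rpow_mul_one_sub_rpow hs hα
  constructor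
  · rw [← integrableOn_congr_fun hcongr measurableSet_Ioi]
    refine (integrableOn_Ioi_comp_rpow_iff' g two_ne_zero).2 ?_
    exact ((integrable_indicator_iff measurableSet_Ioo).2 hint).integrableOn
  · rw [← setIntegral_congr_fun measurableSet_Ioi hcongr]
    have h := integral_comp_rpow_Ioi_of_pos (g := g) two_pos
    simp only [smul_eq_mul, mul_assoc, integral_const_mul] at h
    rw [hg, setIntegral_indicator measurableSet_Ioo, ← hg,
      Set.inter_eq_right.2 Set.Ioo_subset_Ioi_self, hval] at h
    linarith

theorem norm_truncWeight_mul_inner_pow_le {E : Type*} [NormedAddCommGroup E]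
    [InnerProductSpace ℝ E] (α : ℝ) {θ : E} (hθ : ‖θ‖ = 1) (k : ℕ) (y : E) :
    ‖truncWeight α ‖y‖ * ⟪y, θ⟫ ^ k‖ ≤ truncWeight α ‖y‖ := by
  by_cases h : ‖y‖ ∈ Set.Iio (1 : ℝ)
  · rw [norm_mul, Real.norm_of_nonneg (truncWeight_nonneg α (norm_nonneg y)), norm_pow]
    refine mul_le_of_le_one_right (truncWeight_nonneg α (norm_nonneg y))
      (pow_le_one₀ (norm_nonneg _) ?_)
    calc ‖⟪y, θ⟫‖ ≤ ‖y‖ * ‖θ‖ := norm_inner_le_norm y θ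
      _ ≤ 1 := by rw [hθ, mul_one]; exact h.le
  · simp [truncWeight, Set.indicator_of_notMem h]

section

variable {E : Type*} [NormedAddCommGroup E] [InnerProductSpace ℝ E] [FiniteDimensional ℝ E]
  [MeasurableSpace E] [BorelSpace E]

/-- Polar coordinates separate a radial function from a power of a linear form. -/
theorem integral_fun_norm_mul_inner_pow [Nontrivial E] (μ : Measure E) [μ.IsAddHaarMeasure]
    (f : ℝ → ℝ) (θ : E) (k : ℕ) :
    ∫ y, f ‖y‖ * ⟪y, θ⟫ ^ k ∂μ = (∫ ω : sphere (0 : E) 1, ⟪(ω : E), θ⟫ ^ k ∂μ.toSphere) *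
      ∫ r in Set.Ioi (0 : ℝ), r ^ (Module.finrank ℝ E - 1 + k) * f r := by
  calc
    ∫ y, f ‖y‖ * ⟪y, θ⟫ ^ k ∂μ
        = ∫ y : ({0}ᶜ : Set E), f ‖y.1‖ * ⟪y.1, θ⟫ ^ k ∂(μ.comap (↑)) := by
      rw [integral_subtype_comap (measurableSet_singleton _).compl
        fun y ↦ f ‖y‖ * ⟪y, θ⟫ ^ k, restrict_compl_singleton]
    _ = ∫ p : sphere (0 : E) 1 × Set.Ioi (0 : ℝ), ⟪(p.1 : E), θ⟫ ^ k * (p.2.1 ^ k * f p.2.1)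
          ∂μ.toSphere.prod (.volumeIoiPow (Module.finrank ℝ E - 1)) := by
      rw [← μ.measurePreserving_homeomorphUnitSphereProd.integral_comp
        (Homeomorph.measurableEmbedding _)]
      refine integral_congr_ae (.of_forall fun y ↦ ?_)
      have hy : ‖(y : E)‖ ≠ 0 := norm_ne_zero_iff.2 y.2
      simp only [homeomorphUnitSphereProd_apply_snd_coe, homeomorphUnitSphereProd_apply_fst_coe,
        real_inner_smul_left, mul_pow, inv_pow]
      field_simp
    _ = (∫ ω : sphere (0 : E) 1, ⟪(ω : E), θ⟫ ^ k ∂μ.toSphere) *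
          ∫ r : Set.Ioi (0 : ℝ), r.1 ^ k * f r.1 ∂.volumeIoiPow (Module.finrank ℝ E - 1) :=
      integral_prod_mul (fun ω : sphere (0 : E) 1 ↦ ⟪(ω : E), θ⟫ ^ k)
        fun r : Set.Ioi (0 : ℝ) ↦ r.1 ^ k * f r.1
    _ = _ := by
      congr 1
      simp only [Measure.volumeIoiPow, ENNReal.ofReal]
      rw [integral_withDensity_eq_integral_smul,
        integral_subtype_comap measurableSet_Ioi fun a ↦
          Real.toNNReal (a ^ (Module.finrank ℝ E - 1)) • (a ^ k * f a),
        setIntegral_congr_fun measurableSet_Ioi fun x hx ↦ ?_]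
      · rw [NNReal.smul_def, Real.coe_toNNReal _ (pow_nonneg hx.out.le _), smul_eq_mul, pow_add,
          mul_assoc]
      · exact (measurable_subtype_coe.pow_const _).real_toNNReal

theorem integral_exp_neg_norm_sq_mul_inner_pow {θ : E} (hθ : ‖θ‖ = 1) (m : ℕ) :
    ∫ y : E, Real.exp (-‖y‖ ^ 2) * ⟪y, θ⟫ ^ (2 * m) =
      √π ^ (Module.finrank ℝ E - 1) * Real.Gamma (m + 1 / 2) := by
  have hpos : 0 < Module.finrank ℝ E :=
    Module.finrank_pos_iff_exists_ne_zero.2 ⟨θ, norm_ne_zero_iff.1 (by simp [hθ])⟩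
  let i₀ : Fin (Module.finrank ℝ E) := ⟨0, hpos⟩
  have hv : Orthonormal ℝ (({i₀} : Set (Fin (Module.finrank ℝ E))).domRestrict fun _ ↦ θ) :=
    ⟨fun _ ↦ hθ, fun i j hij ↦ (hij (Subsingleton.elim i j)).elim⟩
  obtain ⟨b, hb⟩ := hv.exists_orthonormalBasis_extension_of_card_eq (by simp)
  have hb0 : b i₀ = θ := hb i₀ rfl
  have hmp := b.measurePreserving_repr_symm.comp (PiLp.volume_preserving_toLp _)
  have hemb : MeasurableEmbedding (b.repr.symm ∘ WithLp.toLp 2) :=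
    b.repr.symm.toHomeomorph.measurableEmbedding.comp
      (MeasurableEquiv.toLp 2 _).measurableEmbedding
  rw [← hmp.integral_comp hemb]
  have key (v : Fin (Module.finrank ℝ E) → ℝ) :
      Real.exp (-‖(b.repr.symm ∘ WithLp.toLp 2) v‖ ^ 2) *
        ⟪(b.repr.symm ∘ WithLp.toLp 2) v, θ⟫ ^ (2 * m) =
      ∏ i, (if i = i₀ then v i ^ (2 * m) else 1) * Real.exp (-v i ^ 2) := by
    have h1 : ⟪(b.repr.symm ∘ WithLp.toLp 2) v, θ⟫ = v i₀ := by
      rw [real_inner_comm, ← hb0, ← b.repr_apply_apply]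
      simp
    rw [h1, Finset.prod_mul_distrib, Finset.prod_ite_eq', ← Real.exp_sum]
    simp [EuclideanSpace.norm_sq_eq, mul_comm]
  simp only [key]
  rw [integral_fintype_prod_volume_eq_prod
    (f := fun i (t : ℝ) ↦ (if i = i₀ then t ^ (2 * m) else 1) * Real.exp (-t ^ 2)),
    ← Finset.mul_prod_erase _ _ (Finset.mem_univ i₀)]
  rw [Finset.prod_congr rfl (g := fun _ ↦ √π)]
  · simp only [if_true, integral_pow_mul_exp_neg_sq]
    simp [mul_comm]
  · intro i hi
    simpa [Finset.ne_of_mem_erase hi] using integral_gaussian 1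

theorem integrable_truncWeight_norm [Nontrivial E] {α : ℝ} (hα : 0 < α) :
    Integrable fun y : E ↦ truncWeight α ‖y‖ := by
  have hn : 0 < Module.finrank ℝ E := Module.finrank_pos
  refine (integrable_fun_norm_addHaar volume).2
    (integral_Ioi_pow_mul_truncWeight (s := Module.finrank ℝ E / 2) (by positivity) hα ?_).1
  rw [Nat.cast_pred hn]
  ring

theorem integrable_truncWeight_norm_mul_inner_pow [Nontrivial E] {α : ℝ} (hα : 0 < α) {θ : E}
    (hθ : ‖θ‖ = 1) (k : ℕ) : Integrable fun y : E ↦ truncWeight α ‖y‖ * ⟪y, θ⟫ ^ k :=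
  (integrable_truncWeight_norm hα).mono'
    (((measurable_truncWeight α).comp measurable_norm).mul (by fun_prop)).aestronglyMeasurable
    (.of_forall (norm_truncWeight_mul_inner_pow_le α hθ k))

theorem integral_fun_norm_mul_inner_pow_of_odd (f : ℝ → ℝ) (θ : E) {k : ℕ} (hk : Odd k) :
    ∫ y : E, f ‖y‖ * ⟪y, θ⟫ ^ k = 0 := by
  have h := integral_neg_eq_self (fun y : E ↦ f ‖y‖ * ⟪y, θ⟫ ^ k) volume
  simp only [norm_neg, inner_neg_left, hk.neg_pow, mul_neg, integral_neg] at h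
  linarith

theorem integral_truncWeight_norm_mul_inner_pow [Nontrivial E] {α : ℝ} (hα : 0 < α) {θ : E}
    (hθ : ‖θ‖ = 1) (m : ℕ) :
    ∫ y : E, truncWeight α ‖y‖ * ⟪y, θ⟫ ^ (2 * m) =
      √π ^ (Module.finrank ℝ E - 1) * Real.Gamma (m + 1 / 2) * Real.Gamma α /
        Real.Gamma (m + Module.finrank ℝ E / 2 + α) := by
  have hn : 0 < Module.finrank ℝ E := Module.finrank_pos
  have hs : (0 : ℝ) < m + Module.finrank ℝ E / 2 := by positivity
  have hj : ((Module.finrank ℝ E - 1 + 2 * m : ℕ) : ℝ) + 1 =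
      2 * (m + Module.finrank ℝ E / 2) := by
    push_cast [Nat.cast_pred hn]
    ring
  have hgauss := integral_fun_norm_mul_inner_pow (volume : Measure E)
    (fun r ↦ Real.exp (-r ^ 2)) θ (2 * m)
  have hrad := integral_rpow_mul_exp_neg_rpow (p := 2)
    (q := (Module.finrank ℝ E - 1 + 2 * m : ℕ)) two_pos
    (neg_one_lt_zero.trans_le (Nat.cast_nonneg _))
  rw [hj, mul_div_cancel_left₀ _ two_ne_zero] at hrad
  simp only [Real.rpow_natCast, Real.rpow_two] at hrad
  rw [integral_exp_neg_norm_sq_mul_inner_pow hθ, hrad] at hgauss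
  rw [integral_fun_norm_mul_inner_pow, (integral_Ioi_pow_mul_truncWeight hs hα hj).2, hgauss]
  ring

theorem integral_truncWeight_norm_mul_cexp [Nontrivial E] {α : ℝ} (hα : 0 < α) (ρ : ℝ) {θ : E}
    (hθ : ‖θ‖ = 1) :
    ∫ y : E, (truncWeight α ‖y‖ : ℂ) * Complex.exp (-(Complex.I * ρ) * (⟪y, θ⟫ : ℝ)) =
      ((π ^ ((Module.finrank ℝ E : ℝ) / 2) * Real.Gamma α /
        Real.Gamma (α + Module.finrank ℝ E / 2) *
          besselj ((Module.finrank ℝ E : ℝ) / 2 + α - 1) ρ : ℝ) : ℂ) := by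
  have hn : 0 < Module.finrank ℝ E := Module.finrank_pos
  have hΓ : Real.Gamma (α + Module.finrank ℝ E / 2) ≠ 0 :=
    (Real.Gamma_pos_of_pos (by positivity)).ne'
  let c : ℕ → ℂ := fun k ↦ (-(Complex.I * ρ)) ^ k / k.factorial
  have hc (k : ℕ) : ‖c k‖ = |ρ| ^ k / k.factorial := by simp [c]
  let F : ℕ → E → ℂ := fun k y ↦ ((truncWeight α ‖y‖ * ⟪y, θ⟫ ^ k : ℝ) : ℂ) * c k
  have hF (k : ℕ) : Integrable (F k) :=
    (integrable_truncWeight_norm_mul_inner_pow hα hθ k).ofReal.mul_const _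
  have hsum : Summable fun k ↦ ∫ y, ‖F k y‖ := by
    refine Summable.of_nonneg_of_le (fun k ↦ integral_nonneg fun _ ↦ norm_nonneg _) (fun k ↦ ?_)
      ((Real.summable_pow_div_factorial |ρ|).mul_left (∫ y : E, truncWeight α ‖y‖))
    rw [← hc, ← integral_mul_const]
    refine integral_mono (hF k).norm ((integrable_truncWeight_norm hα).mul_const _) fun y ↦ ?_
    simp only [F]
    rw [norm_mul, Complex.norm_real]
    gcongr
    exact norm_truncWeight_mul_inner_pow_le α hθ k y
  have htsum (y : E) : ∑' k, F k y =
      (truncWeight α ‖y‖ : ℂ) * Complex.exp (-(Complex.I * ρ) * (⟪y, θ⟫ : ℝ)) := by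
    rw [Complex.exp_eq_exp_ℂ]
    refine HasSum.tsum_eq ?_
    convert! (NormedSpace.expSeries_div_hasSum_exp
      (-(Complex.I * ρ) * (⟪y, θ⟫ : ℝ))).mul_left (truncWeight α ‖y‖ : ℂ) using 2 with k
    simp only [F, c]
    push_cast
    ring
  have hs := hasSum_integral_of_summable_integral_norm hF hsum
  simp only [htsum] at hs
  rw [← (mul_right_injective₀ (two_ne_zero' ℕ)).hasSum_iff] at hs
  · rw [← hs.tsum_eq, besselj, ← tsum_mul_left, Complex.ofReal_tsum]
    refine tsum_congr fun m ↦ ?_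
    have hpow : c (2 * m) = (((-1) ^ m * ρ ^ (2 * m) / (2 * m).factorial : ℝ) : ℂ) := by
      simp only [c]
      rw [pow_mul, neg_sq, mul_pow, Complex.I_sq, mul_pow, ← pow_mul]
      push_cast
      ring
    simp only [Function.comp_apply, F]
    rw [integral_mul_const, integral_complex_ofReal, hpow, ← Complex.ofReal_mul,
      integral_truncWeight_norm_mul_inner_pow hα hθ]
    congr 1
    have hdup := Real.Gamma_mul_Gamma_add_half (m + 1 / 2)
    rw [add_assoc, add_halves, Real.Gamma_nat_eq_factorial,
      show (2 : ℝ) * (m + 1 / 2) = (2 * m : ℕ) + 1 by push_cast; ring,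
      Real.Gamma_nat_eq_factorial,
      show (1 : ℝ) - ((2 * m : ℕ) + 1) = -(2 * m : ℕ) by ring, Real.rpow_neg zero_le_two,
      Real.rpow_natCast] at hdup
    have hΓ' : Real.Gamma (m + Module.finrank ℝ E / 2 + α) ≠ 0 :=
      (Real.Gamma_pos_of_pos (by positivity)).ne'
    have hhalf : Real.Gamma (m + 1 / 2) =
        (2 * m).factorial * √π / (2 ^ (2 * m) * m.factorial) := by
      field_simp at hdup ⊢
      linarith
    have hpi : π ^ ((Module.finrank ℝ E : ℝ) / 2) = √π ^ (Module.finrank ℝ E - 1) * √π := by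
      rw [← pow_succ, Nat.sub_add_cancel hn, Real.sqrt_eq_rpow, ← Real.rpow_natCast,
        ← Real.rpow_mul Real.pi_pos.le]
      ring_nf
    rw [hhalf, hpi,
      show (Module.finrank ℝ E : ℝ) / 2 + α - 1 + 1 = α + Module.finrank ℝ E / 2 by ring,
      show (m : ℝ) + (Module.finrank ℝ E / 2 + α - 1) + 1 = m + Module.finrank ℝ E / 2 + α by ring,
      div_pow]
    field_simp
  · intro k hk
    have hodd : Odd k := Nat.not_even_iff_odd.1 fun h ↦ hk (by
      obtain ⟨m, rfl⟩ := h.two_dvd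
      exact ⟨m, rfl⟩)
    simp only [F]
    rw [integral_mul_const, integral_complex_ofReal,
      integral_fun_norm_mul_inner_pow_of_odd _ _ hodd, Complex.ofReal_zero, zero_mul]

end

theorem isProbabilityMeasure_normSphereMeasure {n : ℕ} (hn : n ≠ 0) :
    IsProbabilityMeasure (normSphereMeasure n) := by
  have : Nonempty (Fin n) := ⟨⟨0, Nat.pos_of_ne_zero hn⟩⟩
  have : NeZero (volume : Measure (EuclideanSpace ℝ (Fin n))).toSphere :=
    ⟨Measure.toSphere_ne_zero _⟩
  exact isProbabilityMeasureSMul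

/-- `ψ` is an eigenfunction of the generalized Euler-Poisson-Darboux mean `M_ρ^α`,
with eigenvalue `j_{n/2+α-1}(ρ)`. -/
theorem EPD_mean_psi_eq (n : ℕ) (hn : 2 ≤ n) (α : ℝ) (hα : 0 < α) (ρ : ℝ) (hρ : 0 < ρ)
    (x : EuclideanSpace ℝ (Fin n)) :
    IntegrableOn
      (fun y : EuclideanSpace ℝ (Fin n) =>
        (((1 - ‖y‖ ^ 2) ^ (α - 1) : ℝ) : ℂ) * psiFun n (x - ρ • y))
      (ball (0 : EuclideanSpace ℝ (Fin n)) 1) volume ∧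
    ((Real.Gamma (α + n / 2) / (π ^ ((n : ℝ) / 2) * Real.Gamma α) : ℝ) : ℂ) *
        ∫ y in ball (0 : EuclideanSpace ℝ (Fin n)) 1,
          (((1 - ‖y‖ ^ 2) ^ (α - 1) : ℝ) : ℂ) * psiFun n (x - ρ • y)
      = (besselj ((n : ℝ) / 2 + α - 1) ρ : ℝ) * psiFun n x := by
  have hn0 : n ≠ 0 := by omega
  have : Nonempty (Fin n) := ⟨⟨0, Nat.pos_of_ne_zero hn0⟩⟩
  have := isProbabilityMeasure_normSphereMeasure hn0
  have hind : (ball (0 : EuclideanSpace ℝ (Fin n)) 1).indicator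
      (fun y ↦ (((1 - ‖y‖ ^ 2) ^ (α - 1) : ℝ) : ℂ) * psiFun n (x - ρ • y)) =
      fun y ↦ ∫ θ, (truncWeight α ‖y‖ : ℂ) *
        Complex.exp (Complex.I * (⟪x - ρ • y, (θ : EuclideanSpace ℝ (Fin n))⟫ : ℝ))
        ∂(normSphereMeasure n) := by
    ext y
    rw [integral_const_mul, ← psiFun]
    by_cases h : ‖y‖ < 1
    · simp [truncWeight, h]
    · simp [truncWeight, h]
  have hw : Integrable fun y : EuclideanSpace ℝ (Fin n) ↦ (truncWeight α ‖y‖ : ℂ) :=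
    (integrable_truncWeight_norm hα).ofReal
  have hint : Integrable (Function.uncurry fun (y : EuclideanSpace ℝ (Fin n))
      (θ : sphere (0 : EuclideanSpace ℝ (Fin n)) 1) ↦ (truncWeight α ‖y‖ : ℂ) *
        Complex.exp (Complex.I * (⟪x - ρ • y, (θ : EuclideanSpace ℝ (Fin n))⟫ : ℝ)))
      (volume.prod (normSphereMeasure n)) := by
    refine Integrable.mul_bdd (c := 1) ?_ ?_ ?_
    · exact hw.comp_fst _
    · exact Continuous.aestronglyMeasurable (by fun_prop)
    · refine .of_forall fun p ↦ ?_
      rw [mul_comm, Complex.norm_exp_ofReal_mul_I]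
  rw [← integrable_indicator_iff measurableSet_ball, ← integral_indicator measurableSet_ball, hind]
  refine ⟨hint.integral_prod_left, ?_⟩
  rw [integral_integral_swap hint]
  have hinner (θ : sphere (0 : EuclideanSpace ℝ (Fin n)) 1) :
      ∫ y, (truncWeight α ‖y‖ : ℂ) *
        Complex.exp (Complex.I * (⟪x - ρ • y, (θ : EuclideanSpace ℝ (Fin n))⟫ : ℝ)) =
      ((π ^ ((n : ℝ) / 2) * Real.Gamma α / Real.Gamma (α + n / 2) *
        besselj ((n : ℝ) / 2 + α - 1) ρ : ℝ) : ℂ) *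
        Complex.exp (Complex.I * (⟪x, (θ : EuclideanSpace ℝ (Fin n))⟫ : ℝ)) := by
    have h := integral_truncWeight_norm_mul_cexp hα ρ (norm_eq_of_mem_sphere θ)
    rw [finrank_euclideanSpace_fin] at h
    rw [← h, ← integral_mul_const]
    refine integral_congr_ae (.of_forall fun y ↦ ?_)
    simp only [inner_sub_left, real_inner_smul_left]
    rw [mul_assoc, ← Complex.exp_add]
    congr 2
    push_cast
    ring
  simp only [hinner]
  rw [integral_const_mul, ← psiFun, ← mul_assoc, ← Complex.ofReal_mul]
  congr 2
  have h1 : Real.Gamma (α + n / 2) ≠ 0 := (Real.Gamma_pos_of_pos (by positivity)).ne'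
  have h2 : Real.Gamma α ≠ 0 := (Real.Gamma_pos_of_pos hα).ne'
  have h3 : π ^ ((n : ℝ) / 2) ≠ 0 := (Real.rpow_pos_of_pos Real.pi_pos _).ne'
  field_simp
end

section
/- Let ν > -1 and α > 0 satisfy 2α < ν + 1/2, and let r > 0. Then the function s ↦ (s² - r²)^{α-1} j_ν(s) s is absolutely integrable on (r,∞), and (2/Γ(α)) ∫_r^∞ (s² - r²)^{α-1} j_ν(s) s ds = (2^{2α} Γ(ν+1)/Γ(ν-α+1)) · j_{ν-α}(r). (Erdélyi-Kober fractional integral of the normalized Bessel function.) -/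
open MeasureTheory
open scoped ENNReal

open Filter Topology Set

/-- The entire function `∑ (-t/4)^m / (m! Γ(m+ν+1))`, i.e. `j_ν(√t) / Γ(ν+1)`. -/
noncomputable def besselSeries (ν t : ℝ) : ℝ :=
  ∑' m : ℕ, (-t / 4) ^ m / (m.factorial * Real.Gamma (m + ν + 1))

lemma besselj_eq_besselSeries (ν r : ℝ) :
    besselj ν r = Real.Gamma (ν + 1) * besselSeries ν (r ^ 2) := by
  rw [besselj, besselSeries, ← tsum_mul_left]
  congr 1 with m
  have : (-r ^ 2 / 4) ^ m = (-1) ^ m * (r / 2) ^ (2 * m) := by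
    rw [pow_mul, ← mul_pow]
    ring
  rw [this]
  ring

lemma exists_pos_le_Gamma_natCast_add {ν : ℝ} (hν : -1 < ν) :
    ∃ c > 0, ∀ m : ℕ, c ≤ Real.Gamma (m + ν + 1) := by
  refine ⟨min (Real.Gamma (ν + 1)) (Real.Gamma (ν + 2)),
    lt_min (Real.Gamma_pos_of_pos (by linarith)) (Real.Gamma_pos_of_pos (by linarith)), ?_⟩
  have key : ∀ m : ℕ, Real.Gamma (ν + 2) ≤ Real.Gamma ((m + 1 : ℕ) + ν + 1) := by
    intro m
    induction m with
    | zero => exact le_of_eq (by congr 1; push_cast; ring)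
    | succ m ih =>
      refine ih.trans ?_
      have hm : (0 : ℝ) ≤ m := m.cast_nonneg
      have e : (((m + 1 + 1 : ℕ) : ℝ) + ν + 1) = ((m + 1 : ℕ) + ν + 1) + 1 := by
        push_cast; ring
      rw [e, Real.Gamma_add_one (s := ((m + 1 : ℕ) : ℝ) + ν + 1) (by push_cast; linarith)]
      refine le_mul_of_one_le_left (Real.Gamma_nonneg_of_nonneg ?_) ?_ <;> push_cast <;> linarith
  rintro (_ | m)
  · exact (min_le_left _ _).trans (le_of_eq (by congr 1; push_cast; ring))
  · exact (min_le_right _ _).trans (key m)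

lemma summable_besselSeries {ν : ℝ} (hν : -1 < ν) (t : ℝ) :
    Summable fun m : ℕ => (-t / 4) ^ m / (m.factorial * Real.Gamma (m + ν + 1)) := by
  obtain ⟨c, hc, h⟩ := exists_pos_le_Gamma_natCast_add hν
  refine Summable.of_norm_bounded ((Real.summable_pow_div_factorial (|t| / 4)).div_const c) ?_
  intro m
  have hG : 0 < Real.Gamma (m + ν + 1) := hc.trans_le (h m)
  rw [norm_div, norm_mul, norm_pow, Real.norm_of_nonneg hG.le, div_div, norm_div, norm_neg,
    Real.norm_eq_abs, Real.norm_eq_abs, Real.norm_eq_abs, abs_of_pos (by positivity : (0:ℝ) < 4),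
    abs_of_nonneg (by positivity : (0 : ℝ) ≤ m.factorial)]
  gcongr
  exact h m

lemma hasDerivAt_besselSeries {ν : ℝ} (hν : -1 < ν) (t : ℝ) :
    HasDerivAt (besselSeries ν) (-besselSeries (ν + 1) t / 4) t := by
  obtain ⟨c, hc, h⟩ := exists_pos_le_Gamma_natCast_add hν
  set R : ℝ := |t| + 1
  set g : ℕ → ℝ → ℝ := fun m t => (-t / 4) ^ m / (m.factorial * Real.Gamma (m + ν + 1))
  set g' : ℕ → ℝ → ℝ := fun m t =>
    m * (-t / 4) ^ (m - 1) * (-1 / 4) / (m.factorial * Real.Gamma (m + ν + 1))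
  have hg : ∀ n y, HasDerivAt (g n) (g' n y) y := fun n y =>
    ((((hasDerivAt_id y).neg.div_const 4).pow n).div_const _).congr_deriv (by simp [g'])
  have hsucc : ∀ (n : ℕ) (y : ℝ), g' (n + 1) y =
      (-1 / 4) * ((-y / 4) ^ n / (n.factorial * Real.Gamma (n + (ν + 1) + 1))) := by
    intro n y
    have e : ((n + 1 : ℕ) : ℝ) + ν + 1 = n + (ν + 1) + 1 := by push_cast; ring
    simp only [g', e, Nat.add_sub_cancel, Nat.factorial_succ, Nat.cast_mul]
    have : ((n + 1 : ℕ) : ℝ) ≠ 0 := by positivity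
    field_simp
  set u : ℕ → ℝ := fun n => n * (R / 4) ^ (n - 1) * (1 / 4) / (n.factorial * c)
  have hu : Summable u := by
    rw [← summable_nat_add_iff 1]
    refine ((Real.summable_pow_div_factorial (R / 4)).div_const (4 * c)).congr fun n => ?_
    simp only [u, Nat.add_sub_cancel, Nat.factorial_succ, Nat.cast_mul]
    have : ((n + 1 : ℕ) : ℝ) ≠ 0 := by positivity
    field_simp
  have hbound : ∀ n y, y ∈ Metric.ball (0 : ℝ) R → ‖g' n y‖ ≤ u n := by
    intro n y hy
    rw [mem_ball_zero_iff, Real.norm_eq_abs] at hy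
    have hG : 0 < Real.Gamma (n + ν + 1) := hc.trans_le (h n)
    simp only [g', u, norm_div, norm_mul, norm_pow, norm_neg, Real.norm_eq_abs, abs_one,
      abs_of_pos hG, Nat.abs_cast, abs_of_pos (by positivity : (0:ℝ) < 4)]
    gcongr
    exact h n
  have hR : 0 < R := by positivity
  have hmem : t ∈ Metric.ball (0 : ℝ) R := by simp [R]
  have key := hasDerivAt_tsum_of_isPreconnected (g := g) hu Metric.isOpen_ball
    (convex_ball (0 : ℝ) R).isPreconnected (fun n y _ => hg n y) hbound hmem
    (summable_besselSeries hν t) hmem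
  refine key.congr_deriv ?_
  rw [(Summable.of_norm_bounded hu fun n => hbound n t hmem).tsum_eq_zero_add]
  simp_rw [hsucc, tsum_mul_left]
  simp only [g', besselSeries]
  norm_num
  ring

lemma continuous_besselSeries {ν : ℝ} (hν : -1 < ν) : Continuous (besselSeries ν) :=
  continuous_iff_continuousAt.2 fun t => (hasDerivAt_besselSeries hν t).continuousAt

lemma besselSeries_recurrence {ν : ℝ} (hν : -1 < ν) (t : ℝ) :
    t * besselSeries (ν + 2) t / 4 = (ν + 1) * besselSeries (ν + 1) t - besselSeries ν t := by
  have h1 := (summable_besselSeries (show -1 < ν + 1 by linarith) t).mul_left (ν + 1)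
  have h0 := summable_besselSeries hν t
  simp only [besselSeries]
  rw [← tsum_mul_left (a := ν + 1), ← h1.tsum_sub h0, (h1.sub h0).tsum_eq_zero_add,
    ← tsum_mul_left (a := t),
    ← tsum_div_const]
  have hz : (ν + 1) * ((-t / 4) ^ 0 / ((Nat.factorial 0 : ℝ) *
      Real.Gamma ((0 : ℕ) + (ν + 1) + 1))) -
      (-t / 4) ^ 0 / ((Nat.factorial 0 : ℝ) * Real.Gamma ((0 : ℕ) + ν + 1)) = 0 := by
    have : Real.Gamma (ν + 1) ≠ 0 := (Real.Gamma_pos_of_pos (by linarith)).ne'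
    have : ν + 1 ≠ 0 := by linarith
    simp [Real.Gamma_add_one this]
    field_simp
    ring
  rw [hz, zero_add]
  congr 1 with m
  have hm : (0 : ℝ) ≤ m := m.cast_nonneg
  have e0 : ((m + 1 : ℕ) : ℝ) + ν + 1 = m + ν + 2 := by push_cast; ring
  have e1 : ((m + 1 : ℕ) : ℝ) + (ν + 1) + 1 = m + ν + 2 + 1 := by push_cast; ring
  have e2 : (m : ℝ) + (ν + 2) + 1 = m + ν + 2 + 1 := by ring
  have hp : (m : ℝ) + ν + 2 ≠ 0 := by linarith
  have hG : Real.Gamma (m + ν + 2) ≠ 0 := (Real.Gamma_pos_of_pos (by linarith)).ne'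
  rw [e0, e1, e2, Real.Gamma_add_one hp, Nat.factorial_succ, pow_succ]
  have : (m.factorial : ℝ) ≠ 0 := by positivity
  have : (m : ℝ) + 1 ≠ 0 := by positivity
  push_cast
  field_simp
  ring

/-- Energy estimate for the differential equation satisfied by `besselSeries ν`. -/
lemma exists_besselSeries_bound {ν : ℝ} (hν : -1 / 2 < ν) :
    ∃ C, ∀ t, 0 ≤ t → |besselSeries ν t| ≤ C * (1 + t) ^ (-(ν / 2 + 1 / 4)) := by
  have hν' : -1 < ν := by linarith
  set c := ν + 1 / 2 with hc
  have hc0 : 0 < c := by simp only [hc]; linarith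
  set a := besselSeries ν
  set b := besselSeries (ν + 1)
  have ha : ∀ t, HasDerivAt a (-b t / 4) t := hasDerivAt_besselSeries hν'
  have hb : ∀ t, 0 < t → HasDerivAt b ((a t - (ν + 1) * b t) / t) t := by
    intro t ht
    refine (hasDerivAt_besselSeries (show -1 < ν + 1 by linarith) t).congr_deriv ?_
    have := besselSeries_recurrence hν' t
    rw [show ν + 1 + 1 = ν + 2 by ring, eq_div_iff ht.ne']
    simp only [a, b]
    linarith
  set Q : ℝ → ℝ := fun t => a t ^ 2 + t * b t ^ 2 / 4 - c * (a t * b t)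
  set E : ℝ → ℝ := fun t => t ^ c * Q t
  set T : ℝ := 1 + 4 * c ^ 2
  have hT : 1 ≤ T := by simp only [T]; nlinarith
  have hE : ∀ t, 0 < t → HasDerivAt E (c / 2 * t ^ (c - 1) * (a t * b t)) t := by
    intro t ht
    have h1 := Real.hasDerivAt_rpow_const (p := c) (Or.inl ht.ne')
    have h2 := (((ha t).pow 2).add (((hasDerivAt_id t).mul ((hb t ht).pow 2)).div_const 4)).sub
      (((ha t).mul (hb t ht)).const_mul c)
    refine (h1.mul h2).congr_deriv ?_
    have : t ^ c = t ^ (c - 1) * t := by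
      rw [← Real.rpow_add_one ht.ne']; ring_nf
    simp [this]
    field_simp
    simp only [hc]
    ring
  have hab : ∀ t, T ≤ t → |a t * b t| ≤ (a t ^ 2 + t * b t ^ 2 / 4) / √t ∧
      a t ^ 2 + t * b t ^ 2 / 4 ≤ 2 * Q t := by
    intro t ht
    have ht0 : 0 < t := by linarith
    have hs : 0 < √t := Real.sqrt_pos.2 ht0
    have hsq : √t ^ 2 = t := Real.sq_sqrt ht0.le
    have h1 : |a t * b t| * √t ≤ a t ^ 2 + t * b t ^ 2 / 4 := by
      rw [abs_mul]
      have := sq_nonneg (|a t| - √t * |b t| / 2)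
      have e1 := sq_abs (a t)
      have e2 := sq_abs (b t)
      nlinarith
    have h2 : 2 * c ≤ √t := by
      apply Real.le_sqrt_of_sq_le
      simp only [T] at ht
      nlinarith
    refine ⟨by rwa [le_div_iff₀ hs], ?_⟩
    have h3 : |a t * b t| * (2 * c) ≤ a t ^ 2 + t * b t ^ 2 / 4 :=
      (mul_le_mul_of_nonneg_left h2 (abs_nonneg _)).trans h1
    have h4 := le_abs_self (a t * b t)
    simp only [Q]
    nlinarith
  have hanti : AntitoneOn (fun t => E t * Real.exp (2 * c * t ^ (-1 / 2 : ℝ))) (Ici T) := by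
    have hd : ∀ t, T ≤ t → HasDerivAt (fun t => E t * Real.exp (2 * c * t ^ (-1 / 2 : ℝ)))
        ((c / 2 * t ^ (c - 1) * (a t * b t) - c * t ^ (-3 / 2 : ℝ) * E t) *
          Real.exp (2 * c * t ^ (-1 / 2 : ℝ))) t := by
      intro t ht
      have ht0 : 0 < t := by linarith
      have h1 := ((Real.hasDerivAt_rpow_const (p := (-1 / 2 : ℝ)) (Or.inl ht0.ne')).const_mul
        (2 * c)).exp
      refine ((hE t ht0).mul h1).congr_deriv ?_
      rw [show (-1 / 2 - 1 : ℝ) = -3 / 2 by norm_num]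
      ring
    refine antitoneOn_of_deriv_nonpos (convex_Ici T)
      (fun t ht => (hd t ht).continuousAt.continuousWithinAt) ?_ ?_
    · intro t ht
      rw [interior_Ici] at ht
      exact (hd t (le_of_lt ht)).differentiableAt.differentiableWithinAt
    · intro t ht
      rw [interior_Ici] at ht
      have ht' : T ≤ t := le_of_lt ht
      rw [(hd t ht').deriv]
      refine mul_nonpos_of_nonpos_of_nonneg ?_ (Real.exp_pos _).le
      have ht0 : 0 < t := by linarith
      obtain ⟨h1, h2⟩ := hab t ht'
      have hs : 0 < √t := Real.sqrt_pos.2 ht0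
      have e1 : t ^ (-3 / 2 : ℝ) * t ^ c = t ^ (c - 1) / √t := by
        rw [Real.sqrt_eq_rpow, ← Real.rpow_add ht0, ← Real.rpow_sub ht0]
        ring_nf
      have h3 : a t * b t ≤ 2 * Q t / √t :=
        (le_abs_self _).trans (h1.trans (by gcongr))
      have h4 : c / 2 * t ^ (c - 1) * (a t * b t) ≤ c / 2 * t ^ (c - 1) * (2 * Q t / √t) := by
        gcongr
      have e2 : c * t ^ (-3 / 2 : ℝ) * E t = c / 2 * t ^ (c - 1) * (2 * Q t / √t) := by
        calc c * t ^ (-3 / 2 : ℝ) * E t = c * (t ^ (-3 / 2 : ℝ) * t ^ c) * Q t := by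
              simp only [E]; ring
          _ = _ := by rw [e1]; ring
      linarith
  obtain ⟨M, hM⟩ : ∃ M, ∀ t, T ≤ t → E t ≤ M := by
    refine ⟨E T * Real.exp (2 * c * T ^ (-1 / 2 : ℝ)), fun t ht => ?_⟩
    have ht0 : 0 < t := by linarith
    refine le_trans ?_ (hanti self_mem_Ici ht ht)
    obtain ⟨-, h2⟩ := hab t ht
    have hE0 : 0 ≤ E t := by
      have : 0 ≤ Q t := by
        have : 0 ≤ a t ^ 2 + t * b t ^ 2 / 4 := by positivity
        linarith
      simp only [E]; positivity
    exact le_mul_of_one_le_right hE0 (Real.one_le_exp (by positivity))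
  have hfar : ∀ t, T ≤ t → (1 + t) ^ c * a t ^ 2 ≤ 2 ^ c * (2 * M) := by
    intro t ht
    have ht0 : 0 < t := by linarith
    obtain ⟨-, h2⟩ := hab t ht
    have h3 : a t ^ 2 ≤ 2 * Q t := by
      have : 0 ≤ t * b t ^ 2 / 4 := by positivity
      linarith
    calc (1 + t) ^ c * a t ^ 2 ≤ (2 * t) ^ c * (2 * Q t) := by
          gcongr
          linarith
      _ = 2 ^ c * (2 * E t) := by
          rw [Real.mul_rpow (by norm_num) ht0.le]; simp only [E]; ring
      _ ≤ _ := by gcongr; exact hM t ht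
  have hac : Continuous a := continuous_besselSeries hν'
  obtain ⟨N, hN⟩ : ∃ N, ∀ t ∈ Icc 0 T, (1 + t) ^ c * a t ^ 2 ≤ N := by
    have hcont : ContinuousOn (fun t : ℝ => (1 + t) ^ c * a t ^ 2) (Icc 0 T) := by
      refine ContinuousOn.mul (ContinuousOn.rpow_const (by fun_prop) fun t ht => Or.inr hc0.le) ?_
      fun_prop
    obtain ⟨N, hN⟩ := (isCompact_Icc.image_of_continuousOn hcont).bddAbove
    exact ⟨N, fun t ht => hN (mem_image_of_mem _ ht)⟩
  refine ⟨√(max N (2 ^ c * (2 * M))), fun t ht => ?_⟩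
  have h1 : (0 : ℝ) < 1 + t := by linarith
  have hall : (1 + t) ^ c * a t ^ 2 ≤ max N (2 ^ c * (2 * M)) := by
    rcases le_total t T with h | h
    · exact (hN t ⟨ht, h⟩).trans (le_max_left _ _)
    · exact (hfar t h).trans (le_max_right _ _)
  rw [Real.rpow_neg h1.le, ← div_eq_mul_inv, le_div_iff₀ (by positivity)]
  apply Real.le_sqrt_of_sq_le
  have e : ((1 + t) ^ (ν / 2 + 1 / 4)) ^ 2 = (1 + t) ^ c := by
    rw [← Real.rpow_mul_natCast h1.le, hc]
    push_cast
    ring_nf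
  rwa [mul_pow, sq_abs, e, mul_comm]

lemma integrableOn_rpow_mul_exp_neg_mul {s b : ℝ} (hs : -1 < s) (hb : 0 < b) :
    IntegrableOn (fun t : ℝ => t ^ s * Real.exp (-(b * t))) (Ioi 0) := by
  simpa using integrableOn_rpow_mul_exp_neg_mul_rpow (p := 1) hs one_pos hb

lemma norm_rpow_mul_cexp_neg_mul (s : ℝ) (q : ℂ) {t : ℝ} (ht : 0 < t) :
    ‖((t ^ s : ℝ) : ℂ) * Complex.exp (-(q * t))‖ = t ^ s * Real.exp (-(q.re * t)) := by
  rw [norm_mul, Complex.norm_exp, Complex.norm_real, Real.norm_of_nonneg (by positivity)]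
  simp

lemma measurable_rpow_mul_cexp_neg_mul (s : ℝ) (q : ℂ) :
    Measurable fun t : ℝ => ((t ^ s : ℝ) : ℂ) * Complex.exp (-(q * t)) := by
  fun_prop

lemma integrableOn_rpow_mul_cexp_neg_mul {s : ℝ} (hs : -1 < s) {q : ℂ} (hq : 0 < q.re) :
    IntegrableOn (fun t : ℝ => ((t ^ s : ℝ) : ℂ) * Complex.exp (-(q * t))) (Ioi 0) := by
  refine (integrableOn_rpow_mul_exp_neg_mul hs hq).mono'
    (measurable_rpow_mul_cexp_neg_mul s q).aestronglyMeasurable ?_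
  filter_upwards [ae_restrict_mem measurableSet_Ioi] with t ht
  exact (norm_rpow_mul_cexp_neg_mul s q ht).le

/-- Gamma integral with complex rate. -/
lemma integral_rpow_mul_cexp_neg_mul_Ioi {s : ℝ} (hs : 0 < s) {q : ℂ} (hq : 0 < q.re) :
    ∫ t in Ioi (0 : ℝ), ((t ^ (s - 1) : ℝ) : ℂ) * Complex.exp (-(q * t)) =
      Real.Gamma s * q ^ ((-s : ℝ) : ℂ) := by
  have hs' : -1 < s - 1 := by linarith
  have hopen : IsOpen {z : ℂ | 0 < z.re} := Complex.isOpen_re_gt 0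
  have hF : DifferentiableOn ℂ (fun q : ℂ => ∫ t in Ioi (0 : ℝ),
      ((t ^ (s - 1) : ℝ) : ℂ) * Complex.exp (-(q * t))) {z | 0 < z.re} := by
    intro q₀ (hq₀ : 0 < q₀.re)
    have key := hasDerivAt_integral_of_dominated_loc_of_deriv_le
      (μ := volume.restrict (Ioi (0 : ℝ))) (𝕜 := ℂ) (x₀ := q₀) (s := {z | q₀.re / 2 < z.re})
      (F := fun q t => ((t ^ (s - 1) : ℝ) : ℂ) * Complex.exp (-(q * t)))
      (F' := fun q t => ((t ^ (s - 1) : ℝ) : ℂ) * (Complex.exp (-(q * t)) * (-t)))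
      (bound := fun t => t ^ s * Real.exp (-(q₀.re / 2 * t)))
      ((Complex.isOpen_re_gt _).mem_nhds (by simp only [mem_ofPred_eq]; linarith))
      (Eventually.of_forall fun q =>
        (measurable_rpow_mul_cexp_neg_mul (s - 1) q).aestronglyMeasurable)
      (integrableOn_rpow_mul_cexp_neg_mul hs' hq₀)
      (Measurable.aestronglyMeasurable (by fun_prop)) ?_
      (integrableOn_rpow_mul_exp_neg_mul (by linarith) (by linarith)) ?_
    · exact key.2.differentiableAt.differentiableWithinAt
    · filter_upwards [ae_restrict_mem measurableSet_Ioi] with t ht q hq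
      rw [mem_Ioi] at ht
      change q₀.re / 2 < q.re at hq
      rw [← mul_assoc, norm_mul, norm_rpow_mul_cexp_neg_mul _ _ ht, norm_neg, Complex.norm_real,
        Real.norm_of_nonneg ht.le, mul_right_comm, ← Real.rpow_add_one ht.ne', sub_add_cancel]
      gcongr
    · filter_upwards with t q _
      have := (((hasDerivAt_id q).mul_const (t : ℂ)).neg.cexp).const_mul
        (((t ^ (s - 1) : ℝ) : ℂ))
      simpa using this
  have hG : DifferentiableOn ℂ (fun q : ℂ => (Real.Gamma s : ℂ) * q ^ ((-s : ℝ) : ℂ))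
      {z | 0 < z.re} := fun q hq =>
    ((differentiableAt_id.cpow_const (Or.inl hq)).const_mul _).differentiableWithinAt
  refine (hF.analyticOnNhd hopen).eqOn_of_preconnected_of_frequently_eq (hG.analyticOnNhd hopen)
    (convex_halfSpace_re_gt 0).isPreconnected (z₀ := 1) (by simp) ?_ hq
  have htend : Tendsto (fun x : ℝ => (x : ℂ)) (𝓝[≠] 1) (𝓝[≠] 1) := by
    refine tendsto_nhdsWithin_of_tendsto_nhds_of_eventually_within _ ?_ ?_
    · exact (Complex.continuous_ofReal.tendsto' 1 1 (by simp)).mono_left nhdsWithin_le_nhds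
    · filter_upwards [self_mem_nhdsWithin] with x hx
      simpa using hx
  refine htend.frequently (Eventually.frequently ?_)
  filter_upwards [nhdsWithin_le_nhds (Ioi_mem_nhds (zero_lt_one' ℝ))] with x hx
  rw [mem_Ioi] at hx
  have := Real.integral_rpow_mul_exp_neg_mul_Ioi hs hx
  rw [one_div, Real.inv_rpow hx.le, ← Real.rpow_neg hx.le] at this
  rw [← Complex.ofReal_cpow hx.le, ← Complex.ofReal_mul, mul_comm, ← this]
  refine Eq.trans ?_ (integral_ofReal (𝕜 := ℂ))
  simp

/-- Parametrization of the vertical line `Re z = 1`. -/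
noncomputable def verticalLine (ξ : ℝ) : ℂ := 1 + ((2 * Real.pi * ξ : ℝ) : ℂ) * Complex.I

@[simp] lemma verticalLine_re (ξ : ℝ) : (verticalLine ξ).re = 1 := by simp [verticalLine]

@[simp] lemma verticalLine_im (ξ : ℝ) : (verticalLine ξ).im = 2 * Real.pi * ξ := by
  simp [verticalLine]

lemma verticalLine_ne_zero (ξ : ℝ) : verticalLine ξ ≠ 0 := by
  intro h
  simpa [h] using verticalLine_re ξ

lemma continuous_verticalLine : Continuous verticalLine := by
  unfold verticalLine
  fun_prop

lemma one_le_norm_verticalLine (ξ : ℝ) : 1 ≤ ‖verticalLine ξ‖ := by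
  simpa using Complex.re_le_norm (verticalLine ξ)

lemma norm_exp_verticalLine (ξ : ℝ) : ‖Complex.exp (verticalLine ξ)‖ = Real.exp 1 := by
  rw [Complex.norm_exp, verticalLine_re]

lemma integrable_norm_verticalLine_rpow {s : ℝ} (hs : 1 < s) :
    Integrable fun ξ => ‖verticalLine ξ‖ ^ (-s) := by
  have h := integrable_rpow_neg_one_add_norm_sq (E := ℝ) (μ := volume) (r := s) (by simpa)
  refine h.mono' (continuous_verticalLine.norm.measurable.pow_const _).aestronglyMeasurable ?_
  filter_upwards with ξ
  have h2 : 1 + ‖ξ‖ ^ 2 ≤ ‖verticalLine ξ‖ ^ 2 := by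
    rw [Complex.sq_norm, Complex.normSq_apply, verticalLine_re, verticalLine_im, Real.norm_eq_abs,
      sq_abs]
    have : 1 ≤ Real.pi ^ 2 := by nlinarith [Real.pi_gt_three]
    nlinarith [mul_nonneg (sub_nonneg.2 this) (sq_nonneg ξ), sq_nonneg ξ]
  rw [Real.norm_of_nonneg (by positivity)]
  calc ‖verticalLine ξ‖ ^ (-s) = (‖verticalLine ξ‖ ^ 2) ^ (-s / 2) := by
        rw [← Real.rpow_natCast, ← Real.rpow_mul (norm_nonneg _)]
        congr 1
        push_cast
        ring
    _ ≤ _ := Real.rpow_le_rpow_of_nonpos (by positivity) h2 (by linarith)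

lemma measurable_verticalLine_cpow (s : ℂ) : Measurable fun ξ => verticalLine ξ ^ s :=
  continuous_verticalLine.measurable.pow_const s

lemma integrable_verticalLine_cpow {s : ℝ} (hs : 1 < s) :
    Integrable fun ξ => verticalLine ξ ^ ((-s : ℝ) : ℂ) := by
  refine (integrable_norm_verticalLine_rpow hs).mono'
    (measurable_verticalLine_cpow _).aestronglyMeasurable ?_
  filter_upwards with ξ
  rw [Complex.norm_cpow_real]

lemma integrable_exp_mul_verticalLine_cpow {s : ℝ} (hs : 1 < s) :
    Integrable fun ξ =>
      Complex.exp (verticalLine ξ) * verticalLine ξ ^ ((-s : ℝ) : ℂ) := by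
  refine (integrable_verticalLine_cpow hs).bdd_mul (c := Real.exp 1)
    (continuous_verticalLine.cexp).aestronglyMeasurable ?_
  filter_upwards with ξ
  rw [norm_exp_verticalLine]

/-- Laplace's integral for the reciprocal Gamma function. -/
lemma integral_exp_mul_verticalLine_cpow {s : ℝ} (hs : 1 < s) :
    ∫ ξ, Complex.exp (verticalLine ξ) * verticalLine ξ ^ ((-s : ℝ) : ℂ) =
      ((Real.Gamma s)⁻¹ : ℝ) := by
  have hs0 : 0 < s := by linarith
  set g : ℝ → ℂ := fun t => ((t ^ (s - 1) : ℝ) : ℂ) * Complex.exp (-(1 * t))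
  set f : ℝ → ℂ := (Ioi 0).indicator g
  have hf : Integrable f := (integrable_indicator_iff measurableSet_Ioi).2
    (integrableOn_rpow_mul_cexp_neg_mul (by linarith) (by simp))
  have hFf : FourierTransform.fourier f = fun ξ =>
      (Real.Gamma s : ℂ) * verticalLine ξ ^ ((-s : ℝ) : ℂ) := by
    funext ξ
    rw [Real.fourier_real_eq_integral_exp_smul,
      ← integral_rpow_mul_cexp_neg_mul_Ioi hs0 (by simp), ← integral_indicator measurableSet_Ioi]
    congr 1 with t
    by_cases ht : t ∈ Ioi 0
    · simp only [f, indicator_of_mem ht, g, smul_eq_mul]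
      rw [mul_left_comm, ← Complex.exp_add]
      congr 2
      simp only [verticalLine]
      push_cast
      ring
    · simp [f, indicator_of_notMem ht]
  have hcont : ContinuousAt f 1 := by
    have hg : ContinuousAt g 1 := by
      refine ContinuousAt.mul (Complex.continuous_ofReal.continuousAt.comp ?_) (by fun_prop)
      exact Real.continuousAt_rpow_const _ _ (Or.inl one_ne_zero)
    refine hg.congr ?_
    filter_upwards [Ioi_mem_nhds (zero_lt_one' ℝ)] with t ht
    simp [f, indicator_of_mem ht]
  have hinv := hf.fourierInv_fourier_eq
    (by rw [hFf]; exact (integrable_verticalLine_cpow hs).const_mul _) hcont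
  rw [hFf, Real.fourierInv_eq'] at hinv
  have hf1 : f 1 = Complex.exp (-1) := by
    simp [f, g]
  rw [hf1] at hinv
  have hΓ : (Real.Gamma s : ℂ) ≠ 0 := by exact_mod_cast (Real.Gamma_pos_of_pos hs0).ne'
  calc ∫ ξ, Complex.exp (verticalLine ξ) * verticalLine ξ ^ ((-s : ℝ) : ℂ)
      = ∫ ξ, Complex.exp 1 * (Real.Gamma s : ℂ)⁻¹ *
          (Complex.exp (((2 * Real.pi * inner ℝ ξ (1 : ℝ) : ℝ) : ℂ) * Complex.I) •
          ((Real.Gamma s : ℂ) * verticalLine ξ ^ ((-s : ℝ) : ℂ))) := by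
        congr 1 with ξ
        nth_rewrite 1 [verticalLine]
        rw [Complex.exp_add, smul_eq_mul]
        simp
        field_simp
    _ = _ := by
        rw [integral_const_mul, hinv, mul_right_comm, ← Complex.exp_add]
        simp

/-- Schläfli-type integral for `besselSeries`. -/
lemma integral_schlaefli {ν : ℝ} (hν : 0 < ν) (t : ℝ) :
    ∫ ξ, Complex.exp (verticalLine ξ) * verticalLine ξ ^ ((-(ν + 1) : ℝ) : ℂ) *
      Complex.exp (-((4 * verticalLine ξ)⁻¹ * t)) = besselSeries ν t := by
  set F : ℕ → ℝ → ℂ := fun m ξ => (((-t / 4) ^ m / m.factorial : ℝ) : ℂ) *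
    (Complex.exp (verticalLine ξ) * verticalLine ξ ^ ((-(m + ν + 1) : ℝ) : ℂ))
  have hs : ∀ m : ℕ, 1 < m + ν + 1 := fun m => by
    have : (0 : ℝ) ≤ m := m.cast_nonneg
    linarith
  have hF : ∀ m, Integrable (F m) := fun m =>
    (integrable_exp_mul_verticalLine_cpow (hs m)).const_mul _
  have hsum : Summable fun m => ∫ ξ, ‖F m ξ‖ := by
    refine Summable.of_nonneg_of_le (fun m => integral_nonneg fun ξ => norm_nonneg _) (fun m => ?_)
      ((Real.summable_pow_div_factorial (|t| / 4)).mul_right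
        (∫ ξ, Real.exp 1 * ‖verticalLine ξ‖ ^ (-(ν + 1))))
    rw [← integral_const_mul]
    refine integral_mono (hF m).norm
      (((integrable_norm_verticalLine_rpow (by linarith)).const_mul _).const_mul _) fun ξ => ?_
    simp only [F]
    rw [norm_mul, norm_mul, norm_exp_verticalLine, Complex.norm_cpow_real, Complex.norm_real,
      norm_div, norm_pow, norm_div, norm_neg, Real.norm_natCast, Real.norm_eq_abs,
      Real.norm_of_nonneg (by norm_num : (0 : ℝ) ≤ 4)]
    have : (0 : ℝ) ≤ m := m.cast_nonneg
    gcongr ?_ * (?_ * ?_)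
    exact Real.rpow_le_rpow_of_exponent_le (one_le_norm_verticalLine ξ) (by linarith)
  have key := hasSum_integral_of_summable_integral_norm hF hsum
  have hterm : ∀ ξ, ∑' m, F m ξ = Complex.exp (verticalLine ξ) *
      verticalLine ξ ^ ((-(ν + 1) : ℝ) : ℂ) * Complex.exp (-((4 * verticalLine ξ)⁻¹ * t)) := by
    intro ξ
    have hw := verticalLine_ne_zero ξ
    have h1 := NormedSpace.expSeries_div_hasSum_exp (-((4 * verticalLine ξ)⁻¹ * t) : ℂ)
    rw [← Complex.exp_eq_exp_ℂ] at h1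
    rw [← (h1.mul_left _).tsum_eq]
    congr 1 with m
    have e : ((-(m + ν + 1) : ℝ) : ℂ) = ((-(ν + 1) : ℝ) : ℂ) - m := by push_cast; ring
    have e2 : (-((4 * verticalLine ξ)⁻¹ * t) : ℂ) = (-t / 4) / verticalLine ξ := by
      field_simp
    simp only [F]
    rw [e, Complex.cpow_sub _ _ hw, Complex.cpow_natCast, e2, div_pow (-(t : ℂ) / 4)]
    push_cast
    generalize (-(t : ℂ) / 4) ^ m = y
    ring
  simp_rw [hterm] at key
  rw [← key.tsum_eq, besselSeries, Complex.ofReal_tsum]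
  congr 1 with m
  simp only [F]
  rw [integral_const_mul, integral_exp_mul_verticalLine_cpow (hs m)]
  push_cast
  ring

lemma inv_four_mul_verticalLine_re (ξ : ℝ) :
    ((4 * verticalLine ξ)⁻¹).re = (4 * ‖verticalLine ξ‖ ^ 2)⁻¹ := by
  rw [Complex.inv_re, Complex.normSq_eq_norm_sq, norm_mul]
  have := verticalLine_ne_zero ξ
  simp
  field_simp

lemma inv_four_mul_verticalLine_re_pos (ξ : ℝ) : 0 < ((4 * verticalLine ξ)⁻¹).re := by
  have := one_le_norm_verticalLine ξ
  rw [inv_four_mul_verticalLine_re]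
  positivity

lemma inv_four_mul_verticalLine_cpow_neg (α : ℝ) (ξ : ℝ) :
    (4 * verticalLine ξ)⁻¹ ^ ((-α : ℝ) : ℂ) = ((4 ^ α : ℝ) : ℂ) * verticalLine ξ ^ (α : ℂ) := by
  have harg : (4 * verticalLine ξ).arg ≠ Real.pi := by
    rw [Ne, Complex.arg_eq_pi_iff]
    intro h
    simp at h
    linarith
  have e : (4 : ℂ) = ((4 : ℝ) : ℂ) := by norm_num
  have hw := verticalLine_ne_zero ξ
  have h4 : ((4 : ℝ) : ℂ) ≠ 0 := by norm_num
  rw [Complex.inv_cpow _ _ harg, Complex.ofReal_neg, Complex.cpow_neg, inv_inv, e,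
    Complex.ofReal_cpow (by norm_num), Complex.cpow_def_of_ne_zero (mul_ne_zero h4 hw),
    Complex.cpow_def_of_ne_zero h4, Complex.cpow_def_of_ne_zero hw,
    Complex.log_ofReal_mul (by norm_num) hw, Complex.ofReal_log (by norm_num), add_mul,
    Complex.exp_add]

/-- Weyl fractional integral of `besselSeries ν`, in the range where the Schläfli integral may be
integrated term by term. -/
lemma integral_rpow_mul_besselSeries_of_lt {ν α : ℝ} (hα : 0 < α) (h : 2 * α < ν) {x : ℝ}
    (hx : 0 ≤ x) :
    ∫ u in Ioi (0 : ℝ), u ^ (α - 1) * besselSeries ν (x + u) =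
      Real.Gamma α * 4 ^ α * besselSeries (ν - α) x := by
  have hν : 0 < ν := by linarith
  set G : ℝ → ℂ := fun ξ => Complex.exp (verticalLine ξ) *
    verticalLine ξ ^ ((-(ν + 1) : ℝ) : ℂ) * Complex.exp (-((4 * verticalLine ξ)⁻¹ * x))
  set K : ℝ → ℝ → ℂ := fun u ξ => G ξ *
    (((u ^ (α - 1) : ℝ) : ℂ) * Complex.exp (-((4 * verticalLine ξ)⁻¹ * u)))
  have hwm : Measurable verticalLine := continuous_verticalLine.measurable
  have hGm : Measurable G :=
    (hwm.cexp.mul (measurable_verticalLine_cpow _)).mul (by fun_prop)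
  have hGnorm : ∀ ξ, ‖G ξ‖ ≤ Real.exp 1 * ‖verticalLine ξ‖ ^ (-(ν + 1)) := by
    intro ξ
    simp only [G]
    rw [norm_mul, norm_mul, norm_exp_verticalLine, Complex.norm_cpow_real, Complex.norm_exp]
    refine mul_le_of_le_one_right (by positivity) (Real.exp_le_one_iff.2 ?_)
    have := mul_nonneg (inv_four_mul_verticalLine_re_pos ξ).le hx
    rw [Complex.neg_re, Complex.re_mul_ofReal]
    linarith
  have hKm : Measurable (Function.uncurry K) := by
    simp only [K, Function.uncurry_def]
    exact (hGm.comp measurable_snd).mul (by fun_prop)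
  have hK : Integrable (Function.uncurry K) ((volume.restrict (Ioi 0)).prod volume) := by
    rw [integrable_prod_iff' hKm.aestronglyMeasurable]
    constructor
    · filter_upwards with ξ
      exact (integrableOn_rpow_mul_cexp_neg_mul (s := α - 1) (by linarith)
        (inv_four_mul_verticalLine_re_pos ξ)).const_mul (G ξ)
    · refine Integrable.mono' (g := fun ξ => Real.exp 1 * (4 ^ α * Real.Gamma α) *
        ‖verticalLine ξ‖ ^ (-(ν + 1 - 2 * α)))
        ((integrable_norm_verticalLine_rpow (by linarith)).const_mul _)
        hKm.norm.stronglyMeasurable.integral_prod_left'.aestronglyMeasurable ?_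
      filter_upwards with ξ
      rw [Real.norm_of_nonneg (integral_nonneg fun _ => norm_nonneg _)]
      have hpos := inv_four_mul_verticalLine_re_pos ξ
      have hw : 0 < ‖verticalLine ξ‖ := one_pos.trans_le (one_le_norm_verticalLine ξ)
      have e : ∫ u in Ioi (0 : ℝ), ‖Function.uncurry K (u, ξ)‖ =
          ‖G ξ‖ * ((4 * ‖verticalLine ξ‖ ^ 2) ^ α * Real.Gamma α) := by
        have h1 := Real.integral_rpow_mul_exp_neg_mul_Ioi hα hpos
        rw [inv_four_mul_verticalLine_re, one_div, inv_inv] at h1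
        rw [← h1, ← integral_const_mul]
        refine setIntegral_congr_fun measurableSet_Ioi fun u hu => ?_
        simp only [K, Function.uncurry]
        rw [norm_mul, norm_rpow_mul_cexp_neg_mul _ _ hu, inv_four_mul_verticalLine_re]
      rw [e]
      have e3 : (4 * ‖verticalLine ξ‖ ^ 2) ^ α = 4 ^ α * ‖verticalLine ξ‖ ^ (2 * α) := by
        rw [Real.mul_rpow (by norm_num) (by positivity), Real.rpow_mul hw.le, Real.rpow_two]
      have e4 : ‖verticalLine ξ‖ ^ (-(ν + 1 - 2 * α)) =
          ‖verticalLine ξ‖ ^ (-(ν + 1)) * ‖verticalLine ξ‖ ^ (2 * α) := by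
        rw [← Real.rpow_add hw]
        ring_nf
      have hΓ := Real.Gamma_pos_of_pos hα
      rw [e3, e4]
      calc _ ≤ Real.exp 1 * ‖verticalLine ξ‖ ^ (-(ν + 1)) *
            (4 ^ α * ‖verticalLine ξ‖ ^ (2 * α) * Real.Gamma α) := by
            gcongr
            exact hGnorm ξ
        _ = _ := by ring
  have hswap := integral_integral_swap hK
  have hleft : ∀ u, ∫ ξ, K u ξ = ((u ^ (α - 1) * besselSeries ν (x + u) : ℝ) : ℂ) := by
    intro u
    rw [Complex.ofReal_mul, ← integral_schlaefli hν, ← integral_const_mul]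
    congr 1 with ξ
    simp only [K, G]
    rw [Complex.ofReal_add, mul_add, neg_add ((4 * verticalLine ξ)⁻¹ * (x : ℂ)),
      Complex.exp_add]
    ring
  have hright : ∀ ξ, ∫ u in Ioi (0 : ℝ), K u ξ = ((Real.Gamma α * 4 ^ α : ℝ) : ℂ) *
      (Complex.exp (verticalLine ξ) * verticalLine ξ ^ ((-(ν - α + 1) : ℝ) : ℂ) *
      Complex.exp (-((4 * verticalLine ξ)⁻¹ * x))) := by
    intro ξ
    have e : ((-(ν - α + 1) : ℝ) : ℂ) = ((-(ν + 1) : ℝ) : ℂ) + (α : ℂ) := by push_cast; ring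
    simp only [K, G]
    rw [integral_const_mul, integral_rpow_mul_cexp_neg_mul_Ioi hα
      (inv_four_mul_verticalLine_re_pos ξ), inv_four_mul_verticalLine_cpow_neg, e,
      Complex.cpow_add _ _ (verticalLine_ne_zero ξ), Complex.ofReal_mul]
    ring
  simp_rw [hleft, hright] at hswap
  rw [integral_const_mul, integral_schlaefli (by linarith)] at hswap
  have := (integral_ofReal (𝕜 := ℂ) (μ := volume.restrict (Ioi 0))
    (f := fun u : ℝ => u ^ (α - 1) * besselSeries ν (x + u))).symm.trans hswap
  refine Complex.ofReal_injective (Eq.trans this ?_)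
  push_cast
  ring

lemma integrableOn_rpow_mul_one_add_rpow_neg {α β : ℝ} (hα : 0 < α) (h : α < β) :
    IntegrableOn (fun u : ℝ => u ^ (α - 1) * (1 + u) ^ (-β)) (Ioi 0) := by
  have hm : Measurable fun u : ℝ => u ^ (α - 1) * (1 + u) ^ (-β) := by fun_prop
  rw [← Ioc_union_Ioi_eq_Ioi zero_le_one, integrableOn_union]
  constructor
  · have h1 : IntegrableOn (fun u : ℝ => u ^ (α - 1)) (Ioc 0 1) :=
      (intervalIntegrable_iff_integrableOn_Ioc_of_le zero_le_one).1
        (intervalIntegral.intervalIntegrable_rpow' (by linarith))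
    refine h1.mono' hm.aestronglyMeasurable ?_
    filter_upwards [ae_restrict_mem measurableSet_Ioc] with u hu
    have := hu.1
    rw [Real.norm_of_nonneg (by positivity)]
    exact mul_le_of_le_one_right (by positivity)
      (Real.rpow_le_one_of_one_le_of_nonpos (by linarith) (by linarith))
  · have h1 : IntegrableOn (fun u : ℝ => u ^ (α - 1 - β)) (Ioi 1) :=
      integrableOn_Ioi_rpow_of_lt (by linarith) one_pos
    refine h1.mono' hm.aestronglyMeasurable ?_
    filter_upwards [ae_restrict_mem measurableSet_Ioi] with u hu
    have hu0 : 0 < u := one_pos.trans hu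
    rw [Real.norm_of_nonneg (by positivity), sub_eq_add_neg (α - 1), Real.rpow_add hu0]
    gcongr ?_ * ?_
    exact Real.rpow_le_rpow_of_nonpos hu0 (by linarith) (by linarith)

lemma measurable_rpow_mul_besselSeries (α : ℝ) {ν : ℝ} (hν : -1 < ν) (x : ℝ) :
    Measurable fun u => u ^ (α - 1) * besselSeries ν (x + u) := by
  have := (continuous_besselSeries hν).measurable
  fun_prop

/-- A dominating function for the Weyl fractional integral, uniform on the half-line. -/
lemma exists_norm_rpow_mul_besselSeries_le (α : ℝ) {ν : ℝ} (hν : -1 / 2 < ν) :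
    ∃ C, ∀ x u : ℝ, 0 ≤ x → 0 < u → ‖u ^ (α - 1) * besselSeries ν (x + u)‖ ≤
      C * (u ^ (α - 1) * (1 + u) ^ (-(ν / 2 + 1 / 4))) := by
  obtain ⟨C, hC⟩ := exists_besselSeries_bound hν
  have hC0 : 0 ≤ C := by simpa using (abs_nonneg _).trans (hC 0 le_rfl)
  refine ⟨C, fun x u hx hu => ?_⟩
  rw [norm_mul, Real.norm_of_nonneg (by positivity), mul_left_comm, Real.norm_eq_abs]
  gcongr ?_ * ?_
  refine (hC _ (by positivity)).trans ?_
  gcongr ?_ * ?_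
  exact Real.rpow_le_rpow_of_nonpos (by positivity) (by linarith) (by linarith)

lemma integrableOn_rpow_mul_besselSeries {ν α : ℝ} (hα : 0 < α) (h : 2 * α < ν + 1 / 2)
    {x : ℝ} (hx : 0 ≤ x) :
    IntegrableOn (fun u => u ^ (α - 1) * besselSeries ν (x + u)) (Ioi 0) := by
  obtain ⟨C, hC⟩ := exists_norm_rpow_mul_besselSeries_le α (show -1 / 2 < ν by linarith)
  refine ((integrableOn_rpow_mul_one_add_rpow_neg hα
    (show α < ν / 2 + 1 / 4 by linarith)).const_mul C).mono'
    (measurable_rpow_mul_besselSeries α (by linarith) x).aestronglyMeasurable ?_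
  filter_upwards [ae_restrict_mem measurableSet_Ioi] with u hu
  exact hC x u hx hu

lemma tendsto_besselSeries_atTop {ν : ℝ} (hν : -1 / 2 < ν) :
    Tendsto (besselSeries ν) atTop (𝓝 0) := by
  obtain ⟨C, hC⟩ := exists_besselSeries_bound hν
  refine squeeze_zero_norm' ((eventually_ge_atTop 0).mono fun t ht => hC t ht) ?_
  have h1 : Tendsto (fun t : ℝ => (1 + t) ^ (-(ν / 2 + 1 / 4))) atTop (𝓝 0) :=
    (tendsto_rpow_neg_atTop (by linarith)).comp (tendsto_atTop_add_const_left _ 1 tendsto_id)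
  simpa using h1.const_mul C

lemma tendsto_integral_rpow_mul_besselSeries {ν α : ℝ} (hα : 0 < α) (h : 2 * α < ν + 1 / 2) :
    Tendsto (fun x => ∫ u in Ioi (0 : ℝ), u ^ (α - 1) * besselSeries ν (x + u)) atTop (𝓝 0) := by
  have hν : -1 / 2 < ν := by linarith
  obtain ⟨C, hC⟩ := exists_norm_rpow_mul_besselSeries_le α hν
  suffices Tendsto (fun x => ∫ u in Ioi (0 : ℝ), u ^ (α - 1) * besselSeries ν (x + u)) atTop
      (𝓝 (∫ _ in Ioi (0 : ℝ), (0 : ℝ))) by simpa using this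
  refine tendsto_integral_filter_of_dominated_convergence (l := atTop)
    (fun u => C * (u ^ (α - 1) * (1 + u) ^ (-(ν / 2 + 1 / 4))))
    (Eventually.of_forall fun x =>
      (measurable_rpow_mul_besselSeries α (by linarith) x).aestronglyMeasurable) ?_
    ((integrableOn_rpow_mul_one_add_rpow_neg hα
      (show α < ν / 2 + 1 / 4 by linarith)).const_mul C) ?_
  · filter_upwards [eventually_ge_atTop 0] with x hx
    filter_upwards [ae_restrict_mem measurableSet_Ioi] with u hu
    exact hC x u hx hu
  · filter_upwards with u
    simpa using ((tendsto_besselSeries_atTop hν).comp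
      (tendsto_atTop_add_const_right _ u tendsto_id)).const_mul (u ^ (α - 1))

lemma hasDerivAt_integral_rpow_mul_besselSeries {ν α : ℝ} (hα : 0 < α)
    (h : 2 * α < ν + 1 / 2) {x : ℝ} (hx : 0 < x) :
    HasDerivAt (fun x => ∫ u in Ioi (0 : ℝ), u ^ (α - 1) * besselSeries ν (x + u))
      (-(1 / 4) * ∫ u in Ioi (0 : ℝ), u ^ (α - 1) * besselSeries (ν + 1) (x + u)) x := by
  obtain ⟨C, hC⟩ := exists_norm_rpow_mul_besselSeries_le α (show -1 / 2 < ν + 1 by linarith)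
  rw [← integral_const_mul]
  refine (hasDerivAt_integral_of_dominated_loc_of_deriv_le
    (F' := fun x u => -(1 / 4) * (u ^ (α - 1) * besselSeries (ν + 1) (x + u)))
    (Ioi_mem_nhds hx)
    (Eventually.of_forall fun y =>
      (measurable_rpow_mul_besselSeries α (by linarith) y).aestronglyMeasurable)
    (integrableOn_rpow_mul_besselSeries hα h hx.le)
    ((measurable_rpow_mul_besselSeries α (by linarith) x).const_mul _).aestronglyMeasurable ?_
    (((integrableOn_rpow_mul_one_add_rpow_neg hα
      (show α < (ν + 1) / 2 + 1 / 4 by linarith)).const_mul C).const_mul (1 / 4)) ?_).2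
  · filter_upwards [ae_restrict_mem measurableSet_Ioi] with u hu y hy
    rw [norm_mul, norm_neg, Real.norm_of_nonneg (by norm_num : (0 : ℝ) ≤ 1 / 4)]
    exact mul_le_mul_of_nonneg_left (hC y u (le_of_lt hy) hu) (by norm_num)
  · filter_upwards with u y _
    refine (((hasDerivAt_besselSeries (by linarith) (y + u)).comp_add_const y u).const_mul
      (u ^ (α - 1))).congr_deriv ?_
    ring

/-- Weyl fractional integral of `besselSeries ν`. -/
lemma integral_rpow_mul_besselSeries {ν α : ℝ} (hα : 0 < α) (h : 2 * α < ν + 1 / 2) {x : ℝ}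
    (hx : 0 < x) :
    ∫ u in Ioi (0 : ℝ), u ^ (α - 1) * besselSeries ν (x + u) =
      Real.Gamma α * 4 ^ α * besselSeries (ν - α) x := by
  set D : ℝ → ℝ := fun x => (∫ u in Ioi (0 : ℝ), u ^ (α - 1) * besselSeries ν (x + u)) -
    Real.Gamma α * 4 ^ α * besselSeries (ν - α) x
  have hD : ∀ y ∈ Ioi (0 : ℝ), HasDerivAt D 0 y := by
    intro y hy
    refine ((hasDerivAt_integral_rpow_mul_besselSeries hα h hy).sub
      ((hasDerivAt_besselSeries (ν := ν - α) (by linarith) y).const_mul _)).congr_deriv ?_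
    rw [integral_rpow_mul_besselSeries_of_lt hα (by linarith) (le_of_lt hy),
      show ν + 1 - α = ν - α + 1 by ring]
    ring
  have hconst : ∀ y ∈ Ioi (0 : ℝ), D y = D x := fun y hy =>
    (convex_Ioi (0 : ℝ)).is_const_of_fderivWithin_eq_zero (𝕜 := ℝ)
      (fun z hz => (hD z hz).differentiableAt.differentiableWithinAt)
      (fun z hz => by
        rw [fderivWithin_of_isOpen isOpen_Ioi hz]
        ext
        simp [(hD z hz).deriv]) hy hx
  have hlim : Tendsto D atTop (𝓝 0) := by
    simpa using (tendsto_integral_rpow_mul_besselSeries hα h).sub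
      ((tendsto_besselSeries_atTop (ν := ν - α) (by linarith)).const_mul
        (Real.Gamma α * 4 ^ α))
  have hDx : D x = 0 := tendsto_nhds_unique
    (tendsto_const_nhds.congr' ((eventually_gt_atTop 0).mono fun y hy => (hconst y hy).symm)) hlim
  exact sub_eq_zero.1 hDx

lemma image_sq_sub_sq_Ioi {r : ℝ} (hr : 0 < r) :
    (fun s : ℝ => s ^ 2 - r ^ 2) '' Ioi r = Ioi 0 := by
  ext u
  constructor
  · rintro ⟨s, hs, rfl⟩
    rw [mem_Ioi] at hs ⊢
    nlinarith
  · intro hu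
    rw [mem_Ioi] at hu
    refine ⟨√(r ^ 2 + u), ?_, ?_⟩
    · exact Real.lt_sqrt_of_sq_lt (by linarith)
    · simp only
      rw [Real.sq_sqrt (by positivity)]
      ring

/-- Erdélyi-Kober fractional integral of the normalized Bessel function:
`(2/Γ(α)) ∫_r^∞ (s²-r²)^{α-1} j_ν(s) s ds = 2^{2α} Γ(ν+1)/Γ(ν-α+1) · j_{ν-α}(r)`. -/
theorem erdelyiKober_besselj (ν α : ℝ) (hν : -1 < ν) (hα : 0 < α)
    (h : 2 * α < ν + 1 / 2) (r : ℝ) (hr : 0 < r) :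
    IntegrableOn (fun s : ℝ => (s ^ 2 - r ^ 2) ^ (α - 1) * besselj ν s * s)
      (Set.Ioi r) volume ∧
    (2 / Real.Gamma α) *
        ∫ s in Set.Ioi r, (s ^ 2 - r ^ 2) ^ (α - 1) * besselj ν s * s
      = (2 : ℝ) ^ (2 * α) * Real.Gamma (ν + 1) / Real.Gamma (ν - α + 1) *
          besselj (ν - α) r := by
  have hr2 : 0 < r ^ 2 := by positivity
  have hderiv : ∀ s ∈ Ioi r, HasDerivWithinAt (fun s : ℝ => s ^ 2 - r ^ 2) (2 * s) (Ioi r) s :=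
    fun s _ => by simpa using ((hasDerivAt_pow 2 s).sub_const (r ^ 2)).hasDerivWithinAt
  have hinj : InjOn (fun s : ℝ => s ^ 2 - r ^ 2) (Ioi r) := by
    intro s hs t ht hst
    rw [mem_Ioi] at hs ht
    exact (pow_left_inj₀ (by linarith) (by linarith) two_ne_zero).1 (sub_left_injective hst)
  set g : ℝ → ℝ := fun u =>
    Real.Gamma (ν + 1) / 2 * (u ^ (α - 1) * besselSeries ν (r ^ 2 + u))
  have hg : IntegrableOn g (Ioi 0) :=
    (integrableOn_rpow_mul_besselSeries hα h hr2.le).const_mul _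
  have hcongr : EqOn (fun s => |2 * s| • g (s ^ 2 - r ^ 2))
      (fun s : ℝ => (s ^ 2 - r ^ 2) ^ (α - 1) * besselj ν s * s) (Ioi r) := by
    intro s hs
    rw [mem_Ioi] at hs
    simp only [g, smul_eq_mul]
    rw [abs_of_pos (by linarith), add_sub_cancel, besselj_eq_besselSeries]
    ring
  rw [← image_sq_sub_sq_Ioi hr] at hg
  refine ⟨((integrableOn_image_iff_integrableOn_abs_deriv_smul measurableSet_Ioi hderiv hinj
    g).1 hg).congr_fun hcongr measurableSet_Ioi, ?_⟩
  rw [← setIntegral_congr_fun measurableSet_Ioi hcongr,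
    ← integral_image_eq_integral_abs_deriv_smul measurableSet_Ioi hderiv hinj g,
    image_sq_sub_sq_Ioi hr, integral_const_mul, integral_rpow_mul_besselSeries hα h hr2,
    besselj_eq_besselSeries, Real.rpow_mul (by norm_num), show (2 : ℝ) ^ (2 : ℝ) = 4 by norm_num]
  have h1 : Real.Gamma α ≠ 0 := (Real.Gamma_pos_of_pos hα).ne'
  have h2 : Real.Gamma (ν - α + 1) ≠ 0 := (Real.Gamma_pos_of_pos (by linarith)).ne'
  field_simp
end
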